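/- Let M be a monoid that admits a word-hyperbolic structure with uniqueness over some finite alphabet representing a semigroup or monoid generating set of M, and let A be any finite alphabet representing a semigroup or monoid generating set for M. Then there is a regular language L over A such that (L, M(L)) is a word-hyperbolic structure with uniqueness for M. -/

import Mathlib

/-!
Statement 8 (Proposition 4.1): if a monoid admits a word-hyperbolic structure with
uniqueness over some finite alphabet representing a semigroup or monoid generating
set, then it admits one over any finite alphabet representing a semigroup or monoid
generating set.
-/

/-- Words over the alphabet `A`. -/
abbrev Word (A : Type) : Type := List A

/-- The alphabet `A ∪ {#₁, #₂}`. -/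
inductive Hash (A : Type) : Type
  | letter : A → Hash A
  | h1 : Hash A
  | h2 : Hash A

/-- The element of the monoid `M` represented by a word over an alphabet `A` whose
letters represent (via `σ`) elements of `M`. -/
def evalWord {A M : Type} [Monoid M] (σ : A → M) (w : Word A) : M :=
  (w.map σ).prod

/-- The alphabet `A` represents (via `σ`) a monoid generating set for `M`:
every element of `M` is represented by some word over `A`. -/
def RepMonoidGen {A M : Type} [Monoid M] (σ : A → M) : Prop :=
  ∀ m : M, ∃ w : Word A, evalWord σ w = m

/-- The alphabet `A` represents (via `σ`) a semigroup generating set for `M`: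
every element of `M` is represented by some non-empty word over `A`. -/
def RepSemigroupGen {A M : Type} [Monoid M] (σ : A → M) : Prop :=
  ∀ m : M, ∃ w : Word A, w ≠ [] ∧ evalWord σ w = m

/-- The multiplication language
`M(L) = { u #₁ v #₂ wʳᵉᵛ : u, v, w ∈ L, uv =_M w }`. -/
def multTable {A M : Type} [Monoid M] (σ : A → M) (L : Language A) :
    Language (Hash A) :=
  { x | ∃ u v w : Word A, u ∈ L ∧ v ∈ L ∧ w ∈ L ∧
      evalWord σ (u ++ v) = evalWord σ w ∧
      x = u.map Hash.letter ++ [Hash.h1] ++ v.map Hash.letter ++ [Hash.h2]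
            ++ (w.map Hash.letter).reverse }

/-- `(L, M(L))` is a word-hyperbolic structure with uniqueness for `M` over the
alphabet `A` (with letters interpreted by `σ`): `L` is regular, maps bijectively
onto `M`, and `M(L)` is context-free. -/
def IsWordHypStructureWithUniqueness {A M : Type} [Monoid M]
    (σ : A → M) (L : Language A) : Prop :=
  L.IsRegular ∧ (∀ m : M, ∃! w : Word A, w ∈ L ∧ evalWord σ w = m) ∧
    Language.IsContextFree (multTable σ L)

namespace Language

variable {α β : Type*}

/-- The image of a regular language under the homomorphism of free monoids extending `f`
is regular. -/
theorem IsRegular.image_flatMap [Finite β] {K : Language β} (hK : K.IsRegular) (f : β → List α) :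
    Language.IsRegular ((fun w => w.flatMap f) '' K : Set (List α)) := by
  let L : Language α := ((fun w => w.flatMap f) '' K : Set (List α))
  change L.IsRegular
  let F : Set (List α) := insert [] (⋃ b, {t | t <:+ f b})
  have hF : F.Finite := by
    refine Set.Finite.insert _ (Set.finite_iUnion fun b => ?_)
    refine (List.finite_toSet (f b).tails).subset fun t ht => ?_
    simpa using ht
  let pieces : Set (List α × Language β) := F ×ˢ Set.range K.leftQuotient
  have hpieces : pieces.Finite := hF.prod hK.finite_range_leftQuotient
  let union : Set (List α × Language β) → Language α :=
    fun P => ({y | ∃ p ∈ P, ∃ w ∈ p.2, y = p.1 ++ w.flatMap f} : Set (List α))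
  refine .of_finite_range_leftQuotient ((hpieces.finite_subsets.image union).subset ?_)
  rintro _ ⟨x, rfl⟩
  refine ⟨{p ∈ pieces | ∀ w ∈ p.2, x ++ (p.1 ++ w.flatMap f) ∈ L}, Set.sep_subset _ _, ?_⟩
  ext y
  constructor
  · rintro ⟨p, ⟨-, hp⟩, w, hw, rfl⟩
    exact hp w hw
  · rintro ⟨z, hz, hzy⟩
    replace hz : z ∈ K := hz
    replace hzy : (z.map f).flatten = x ++ y := List.flatMap_def.symm.trans hzy
    rcases List.flatten_eq_append_iff.1 hzy with
      ⟨as, bs, h, rfl, rfl⟩ | ⟨as, s, c, t, ds, h, rfl, rfl⟩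
    · obtain ⟨w₁, w₂, rfl, rfl, rfl⟩ := List.map_eq_append_iff.1 h
      refine ⟨([], K.leftQuotient w₁), ⟨⟨Set.mem_insert _ _, w₁, rfl⟩, fun w hw => ?_⟩,
        w₂, hz, by simp [List.flatMap_def]⟩
      exact ⟨w₁ ++ w, hw, by simp [List.flatMap_def]⟩
    · obtain ⟨w₁, _, rfl, rfl, h'⟩ := List.map_eq_append_iff.1 h
      obtain ⟨b, w₂, rfl, hb, rfl⟩ := List.map_eq_cons_iff.1 h'
      refine ⟨(c :: t, K.leftQuotient (w₁ ++ [b])),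
        ⟨⟨Set.mem_insert_of_mem _ (Set.mem_iUnion.2 ⟨b, s, hb.symm⟩), _, rfl⟩, fun w hw => ?_⟩,
        w₂, by simpa using hz, by simp [List.flatMap_def]⟩
      exact ⟨w₁ ++ [b] ++ w, hw, by simp [List.flatMap_def, hb]⟩

end Language

/-- A deterministic sequential transducer from words over `T` to words over `T'`, with
states `Q`. -/
structure Transducer (T T' Q : Type*) where
  /-- The transition function. -/
  step : Q → T → Q
  /-- The word written when reading a letter in a given state. -/
  out : Q → T → List T'

namespace Transducer

variable {T T' Q N : Type*} (D : Transducer T T' Q)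

/-- The state reached from `q` after reading a word. -/
def eval (q : Q) (w : List T) : Q := w.foldl D.step q

/-- The word written when reading a word from the state `q`. -/
def run : Q → List T → List T'
  | _, [] => []
  | q, t :: w => D.out q t ++ run (D.step q t) w

@[simp] lemma eval_nil (q : Q) : D.eval q [] = q := rfl

@[simp] lemma eval_cons (q : Q) (t : T) (w : List T) :
    D.eval q (t :: w) = D.eval (D.step q t) w := rfl

@[simp] lemma run_nil (q : Q) : D.run q [] = [] := rfl

@[simp] lemma run_cons (q : Q) (t : T) (w : List T) :
    D.run q (t :: w) = D.out q t ++ D.run (D.step q t) w := rfl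

lemma eval_append (q : Q) (v w : List T) : D.eval q (v ++ w) = D.eval (D.eval q v) w :=
  List.foldl_append

lemma run_append (q : Q) (v w : List T) :
    D.run q (v ++ w) = D.run q v ++ D.run (D.eval q v) w := by
  induction v generalizing q with
  | nil => rfl
  | cons t v ih => simp [ih]

/-- `D.Annotates p u q v` means that `v` is a translation of the sentential form `u` by `D`,
going from state `p` to state `q`, where every nonterminal is annotated by guessed states before
and after it. -/
inductive Annotates : Q → List (Symbol T N) → Q → List (Symbol T' (Q × N × Q)) → Prop
  | nil (q : Q) : Annotates q [] q []
  | terminal {p q : Q} (t : T) {u : List (Symbol T N)} {v : List (Symbol T' (Q × N × Q))}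
      (h : Annotates (D.step p t) u q v) :
      Annotates p (.terminal t :: u) q ((D.out p t).map .terminal ++ v)
  | nonterminal (p : Q) {r q : Q} (n : N) {u : List (Symbol T N)}
      {v : List (Symbol T' (Q × N × Q))} (h : Annotates r u q v) :
      Annotates p (.nonterminal n :: u) q (.nonterminal (p, n, r) :: v)

variable {D}

namespace Annotates

variable {p q r : Q} {u u₁ u₂ : List (Symbol T N)} {v v₁ v₂ : List (Symbol T' (Q × N × Q))}

lemma append (h₁ : D.Annotates p u₁ r v₁) (h₂ : D.Annotates r u₂ q v₂) :
    D.Annotates p (u₁ ++ u₂) q (v₁ ++ v₂) := by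
  induction h₁ with
  | nil => exact h₂
  | terminal t _ ih => simpa using (ih h₂).terminal t
  | nonterminal p n _ ih => exact (ih h₂).nonterminal p n

lemma exists_of_append (h : D.Annotates p (u₁ ++ u₂) q v) :
    ∃ r v₁ v₂, v = v₁ ++ v₂ ∧ D.Annotates p u₁ r v₁ ∧ D.Annotates r u₂ q v₂ := by
  induction u₁ generalizing p v with
  | nil => exact ⟨p, [], v, rfl, .nil p, h⟩
  | cons a u₁ ih =>
    cases h with
    | terminal t h =>
      obtain ⟨r, v₁, v₂, rfl, h₁, h₂⟩ := ih h
      exact ⟨r, _, v₂, by simp, h₁.terminal t, h₂⟩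
    | nonterminal _ n h =>
      obtain ⟨r, v₁, v₂, rfl, h₁, h₂⟩ := ih h
      exact ⟨r, _, v₂, by simp, h₁.nonterminal p n, h₂⟩

lemma exists_of_nonterminal {a b : Q} {n : N} (h : D.Annotates p u q v)
    (hv : v = v₁ ++ .nonterminal (a, n, b) :: v₂) :
    ∃ u₁ u₂, u = u₁ ++ .nonterminal n :: u₂ ∧
      D.Annotates p u₁ a v₁ ∧ D.Annotates b u₂ q v₂ := by
  induction h generalizing v₁ with
  | nil => simp at hv
  | @terminal p q t u v h ih =>
    rcases List.append_eq_append_iff.1 hv with ⟨c, rfl, h'⟩ | ⟨c, h', hc⟩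
    · obtain ⟨u₁, u₂, rfl, h₁, h₂⟩ := ih h'
      exact ⟨_, u₂, by simp, h₁.terminal t, h₂⟩
    · cases c with
      | nil =>
        obtain ⟨u₁, u₂, rfl, h₁, h₂⟩ := ih (v₁ := []) (by simpa using hc.symm)
        refine ⟨.terminal t :: u₁, u₂, rfl, ?_, h₂⟩
        simpa [h'] using h₁.terminal t
      | cons s c =>
        obtain ⟨rfl, -⟩ := List.cons_eq_cons.1 hc
        have : Symbol.nonterminal (a, n, b) ∈ (D.out p t).map Symbol.terminal := by simp [h']
        simp at this
  | nonterminal p m h ih =>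
    cases v₁ with
    | nil =>
      simp only [List.nil_append, List.cons.injEq, Symbol.nonterminal.injEq, Prod.mk.injEq] at hv
      obtain ⟨⟨rfl, rfl, rfl⟩, rfl⟩ := hv
      exact ⟨[], _, rfl, .nil _, h⟩
    | cons s v₁ =>
      simp only [List.cons_append, List.cons.injEq] at hv
      obtain ⟨rfl, hv⟩ := hv
      obtain ⟨u₁, u₂, rfl, h₁, h₂⟩ := ih hv
      exact ⟨_, u₂, by simp, h₁.nonterminal p m, h₂⟩

lemma map_terminal (p : Q) (w : List T) :
    D.Annotates (N := N) p (w.map .terminal) (D.eval p w) ((D.run p w).map .terminal) := by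
  induction w generalizing p with
  | nil => exact .nil p
  | cons t w ih => simpa using (ih (D.step p t)).terminal t

lemma exists_of_map_terminal {y : List T'} (h : D.Annotates p u q v)
    (hv : v = y.map .terminal) :
    ∃ x, u = x.map .terminal ∧ D.eval p x = q ∧ D.run p x = y := by
  induction h generalizing y with
  | nil => exact ⟨[], rfl, rfl, by simpa using hv.symm⟩
  | terminal t h ih =>
    obtain ⟨y₁, y₂, rfl, h₁, h₂⟩ := List.map_eq_append_iff.1 hv.symm
    obtain ⟨x, rfl, rfl, rfl⟩ := ih h₂.symm
    refine ⟨t :: x, rfl, rfl, ?_⟩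
    have : y₁ = D.out _ t := List.map_injective_iff.2 (fun _ _ => Symbol.terminal.inj) h₁
    simp [this]
  | nonterminal p n h ih => cases y <;> simp at hv

lemma singleton (p : Q) (n : N) (q : Q) :
    D.Annotates p [.nonterminal n] q [.nonterminal (p, n, q)] :=
  (nil q).nonterminal p n

variable (D) in
lemma finite [Finite Q] (p : Q) (u : List (Symbol T N)) (q : Q) :
    {v | D.Annotates p u q v}.Finite := by
  induction u generalizing p with
  | nil =>
    refine (Set.finite_singleton []).subset ?_
    rintro v ⟨⟩
    rfl
  | cons a u ih =>
    cases a with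
    | terminal t =>
      refine ((ih (D.step p t)).image fun v => (D.out p t).map .terminal ++ v).subset ?_
      rintro v (_ | ⟨_, h⟩ | _)
      exact ⟨_, h, rfl⟩
    | nonterminal n =>
      refine (Set.finite_iUnion fun r =>
        (ih r).image fun v => .nonterminal (p, n, r) :: v).subset ?_
      rintro v (_ | _ | ⟨_, _, h⟩)
      exact Set.mem_iUnion.2 ⟨_, _, h, rfl⟩

end Annotates

variable (D)

/-- The rules obtained by annotating the right-hand sides of the rules of `g`. -/
def annotatedRules (g : ContextFreeGrammar T) : Set (ContextFreeRule T' (Q × g.NT × Q)) :=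
  ⋃ r ∈ g.rules, ⋃ p : Q, ⋃ q : Q,
    (fun v => ⟨(p, r.input, q), v⟩) '' {v | D.Annotates p r.output q v}

lemma mem_annotatedRules {g : ContextFreeGrammar T} {s : ContextFreeRule T' (Q × g.NT × Q)} :
    s ∈ D.annotatedRules g ↔
      ∃ r ∈ g.rules, ∃ p q v, D.Annotates p r.output q v ∧ ⟨(p, r.input, q), v⟩ = s := by
  simp [annotatedRules]

lemma finite_annotatedRules [Finite Q] (g : ContextFreeGrammar T) :
    (D.annotatedRules g).Finite :=
  g.rules.finite_toSet.biUnion fun _ _ => Set.finite_iUnion fun _ => Set.finite_iUnion fun _ =>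
    (Annotates.finite D _ _ _).image _

end Transducer

namespace Transducer

variable {T T' Q : Type} [Finite Q] (D : Transducer T T' Q)

/-- The grammar generating the translations of the words of `g` along which `D` goes from the
state `p` to the state `q`. -/
noncomputable def grammar (g : ContextFreeGrammar T) (p q : Q) : ContextFreeGrammar T' where
  NT := Q × g.NT × Q
  initial := (p, g.initial, q)
  rules := (D.finite_annotatedRules g).toFinset

variable {D} {g : ContextFreeGrammar T} {a b p q : Q}

lemma exists_produces_of_produces {u u' : List (Symbol T g.NT)}
    {v' : List (Symbol T' (Q × g.NT × Q))} (h : g.Produces u u') (h' : D.Annotates p u' q v') :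
    ∃ v, D.Annotates p u q v ∧ (D.grammar g a b).Produces v v' := by
  obtain ⟨r, hr, hu⟩ := h
  obtain ⟨u₁, u₂, rfl, rfl⟩ := hu.exists_parts
  obtain ⟨s, _, v₂, rfl, h', h₂⟩ := h'.exists_of_append
  obtain ⟨t, v₁, v, rfl, h₁, h'⟩ := h'.exists_of_append
  refine ⟨_, (h₁.append (.singleton t r.input s)).append h₂, ⟨(t, r.input, s), v⟩, ?_,
    ContextFreeRule.rewrites_of_exists_parts _ v₁ v₂⟩
  exact (D.finite_annotatedRules g).mem_toFinset.2
    (D.mem_annotatedRules.2 ⟨r, hr, t, s, v, h', rfl⟩)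

lemma exists_produces_of_grammar_produces {u : List (Symbol T g.NT)}
    {v v' : List (Symbol T' (Q × g.NT × Q))} (h : (D.grammar g a b).Produces v v')
    (h' : D.Annotates p u q v) :
    ∃ u', D.Annotates p u' q v' ∧ g.Produces u u' := by
  obtain ⟨s, hs, hv⟩ := h
  obtain ⟨r, hr, c, d, w, hw, rfl⟩ :=
    D.mem_annotatedRules.1 ((D.finite_annotatedRules g).mem_toFinset.1 hs)
  obtain ⟨v₁, v₂, rfl, rfl⟩ := hv.exists_parts
  obtain ⟨u₁, u₂, rfl, h₁, h₂⟩ := h'.exists_of_nonterminal (v₁ := v₁) (v₂ := v₂) (by simp; rfl)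
  refine ⟨_, (h₁.append hw).append h₂, r, hr, ?_⟩
  simpa using r.rewrites_of_exists_parts u₁ u₂

/-- Translating the words of a context-free language along which a sequential transducer goes from
`p` to `q` gives a context-free language. -/
theorem isContextFree_image_run {C : Language T} (hC : C.IsContextFree) (p q : Q) :
    Language.IsContextFree (D.run p '' {x | x ∈ C ∧ D.eval p x = q} : Set (List T')) := by
  obtain ⟨g, rfl⟩ := hC
  refine ⟨D.grammar g p q, ?_⟩
  ext y
  constructor
  · intro hy
    have key : ∀ v, (D.grammar g p q).Derives [.nonterminal (p, g.initial, q)] v →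
        ∃ u, D.Annotates p u q v ∧ g.Derives [.nonterminal g.initial] u := by
      intro v hv
      induction hv with
      | refl => exact ⟨_, .singleton _ _ _, .refl _⟩
      | tail _ h ih =>
        obtain ⟨u, hu, hd⟩ := ih
        obtain ⟨u', hu', hp⟩ := exists_produces_of_grammar_produces h hu
        exact ⟨u', hu', hd.tail hp⟩
    obtain ⟨u, hu, hd⟩ := key _ hy
    obtain ⟨x, rfl, hx, rfl⟩ := hu.exists_of_map_terminal rfl
    exact ⟨x, ⟨hd, hx⟩, rfl⟩
  · rintro ⟨x, ⟨hx, rfl⟩, rfl⟩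
    have key : ∀ u, g.Derives u (x.map .terminal) → ∃ v, D.Annotates p u (D.eval p x) v ∧
        (D.grammar g p (D.eval p x)).Derives v ((D.run p x).map .terminal) := by
      intro u hu
      induction hu using Relation.ReflTransGen.head_induction_on with
      | refl => exact ⟨_, .map_terminal p x, .refl _⟩
      | head h _ ih =>
        obtain ⟨v, hv, hd⟩ := ih
        obtain ⟨v', hv', hp⟩ := exists_produces_of_produces h hv
        exact ⟨v', hv', hd.head hp⟩
    obtain ⟨v, hv, hd⟩ := key _ hx
    rcases hv with _ | _ | ⟨_, _, ⟨⟩⟩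
    exact hd

end Transducer

section ChangeOfGenerators

variable {A B M : Type}

/-- The transducer replacing every letter `b` by the word `f b` before `#₂`, and by the reverse
of `f b` after `#₂`. -/
def hashTransducer (f : B → Word A) : Transducer (Hash B) (Hash A) Bool where
  step
    | q, .letter _ => q
    | q, .h1 => q
    | _, .h2 => true
  out
    | false, .letter b => (f b).map .letter
    | true, .letter b => (f b).reverse.map .letter
    | _, .h1 => [.h1]
    | _, .h2 => [.h2]

lemma eval_hashTransducer_map_letter (f : B → Word A) (q : Bool) (w : Word B) :
    (hashTransducer f).eval q (w.map .letter) = q := by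
  induction w with
  | nil => rfl
  | cons b w ih => exact ih

lemma run_hashTransducer_map_letter_false (f : B → Word A) (w : Word B) :
    (hashTransducer f).run false (w.map .letter) = (w.flatMap f).map .letter := by
  induction w with
  | nil => rfl
  | cons b w ih =>
    simp only [List.map_cons, Transducer.run_cons, List.flatMap_cons, List.map_append]
    exact congrArg _ ih

lemma run_hashTransducer_map_letter_true (f : B → Word A) (w : Word B) :
    (hashTransducer f).run true (w.map .letter).reverse =
      ((w.flatMap f).map .letter).reverse := by
  induction w with
  | nil => rfl
  | cons b w ih =>
    rw [List.map_cons, List.reverse_cons, Transducer.run_append, ih, ← List.map_reverse (l := w),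
      eval_hashTransducer_map_letter]
    simp [hashTransducer]

lemma eval_hashTransducer (f : B → Word A) (u v w : Word B) :
    (hashTransducer f).eval false (u.map .letter ++ [.h1] ++ v.map .letter ++ [.h2] ++
      (w.map .letter).reverse) = true := by
  rw [Transducer.eval_append, ← List.map_reverse, Transducer.eval_append]
  exact eval_hashTransducer_map_letter f _ _

lemma run_hashTransducer (f : B → Word A) (u v w : Word B) :
    (hashTransducer f).run false (u.map .letter ++ [.h1] ++ v.map .letter ++ [.h2] ++
      (w.map .letter).reverse) =
    (u.flatMap f).map .letter ++ [.h1] ++ (v.flatMap f).map .letter ++ [.h2] ++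
      ((w.flatMap f).map .letter).reverse := by
  have h1 : ∀ q, (hashTransducer f).eval q [.h1] = q := fun _ => rfl
  have h2 : ∀ q, (hashTransducer f).eval q [.h2] = true := fun _ => rfl
  have h3 : (hashTransducer f).run false [.h1] = [.h1] := rfl
  have h4 : (hashTransducer f).run false [.h2] = [.h2] := rfl
  simp only [Transducer.run_append, Transducer.eval_append, eval_hashTransducer_map_letter, h1, h2,
    h3, h4, run_hashTransducer_map_letter_false, run_hashTransducer_map_letter_true]

variable [Monoid M]

lemma evalWord_append (σ : A → M) (u v : Word A) :
    evalWord σ (u ++ v) = evalWord σ u * evalWord σ v := by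
  simp [evalWord]

lemma evalWord_flatMap {σ : A → M} {τ : B → M} {f : B → Word A}
    (hf : ∀ b, evalWord σ (f b) = τ b) (w : Word B) :
    evalWord σ (w.flatMap f) = evalWord τ w := by
  induction w with
  | nil => rfl
  | cons b w ih =>
    rw [List.flatMap_cons, evalWord_append, hf, ih]
    simp [evalWord]

lemma multTable_image_flatMap {σ : A → M} {τ : B → M} {f : B → Word A}
    (hf : ∀ b, evalWord σ (f b) = τ b) (K : Language B) :
    multTable σ ((fun w => w.flatMap f) '' K : Set (Word A)) =
      ((hashTransducer f).run false ''
        {x | x ∈ multTable τ K ∧ (hashTransducer f).eval false x = true} : Set _) := by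
  ext y
  constructor
  · rintro ⟨_, _, _, ⟨u, hu, rfl⟩, ⟨v, hv, rfl⟩, ⟨w, hw, rfl⟩, h, rfl⟩
    refine ⟨_, ⟨⟨u, v, w, hu, hv, hw, ?_, rfl⟩, eval_hashTransducer f u v w⟩,
      run_hashTransducer f u v w⟩
    simpa [evalWord_append, evalWord_flatMap hf] using h
  · rintro ⟨_, ⟨⟨u, v, w, hu, hv, hw, h, rfl⟩, -⟩, rfl⟩
    refine ⟨_, _, _, ⟨u, hu, rfl⟩, ⟨v, hv, rfl⟩, ⟨w, hw, rfl⟩, ?_, run_hashTransducer f u v w⟩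
    simpa [evalWord_append, evalWord_flatMap hf] using h

end ChangeOfGenerators

/-- **Proposition 4.1.** Let `M` be a monoid admitting a word-hyperbolic structure
with uniqueness over some finite alphabet `B` representing a semigroup or monoid
generating set, and let `A` be any finite alphabet representing a semigroup or monoid
generating set for `M`. Then there is a language `L` over `A` such that `(L, M(L))`
is a word-hyperbolic structure with uniqueness for `M`. -/
theorem exists_wordHypStructureWithUniqueness_of_changeGenerators
    {M : Type} [Monoid M]
    {B : Type} [Fintype B] (τ : B → M)
    (hgenB : RepSemigroupGen τ ∨ RepMonoidGen τ)
    (K : Language B) (hK : IsWordHypStructureWithUniqueness τ K)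
    {A : Type} [Fintype A] (σ : A → M)
    (hgenA : RepSemigroupGen σ ∨ RepMonoidGen σ) :
    ∃ L : Language A, IsWordHypStructureWithUniqueness σ L := by
  have hgen : RepMonoidGen σ := hgenA.elim (fun h m => (h m).imp fun _ => And.right) id
  choose f hf using fun b => hgen (τ b)
  obtain ⟨hreg, hbij, hcf⟩ := hK
  refine ⟨((fun w => w.flatMap f) '' K : Set (Word A)), hreg.image_flatMap f, fun m => ?_, ?_⟩
  · obtain ⟨w, ⟨hw, rfl⟩, huniq⟩ := hbij m
    refine ⟨w.flatMap f, ⟨⟨w, hw, rfl⟩, evalWord_flatMap hf w⟩, ?_⟩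
    rintro _ ⟨⟨w', hw', rfl⟩, h⟩
    exact congrArg _ (huniq w' ⟨hw', (evalWord_flatMap hf w').symm.trans h⟩)
  · rw [multTable_image_flatMap hf]
    exact Transducer.isContextFree_image_run hcf _ _
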